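/- arXiv:2007.02654 — 2 statements merged into one kernel-verified Lean document; each statement's English description precedes it below -/
import Mathlib

section
/- Let d ≥ 1 and m ≥ 0 be natural numbers, and let L be a d×d matrix with entries in the field ℂ((z)) of formal Laurent series, such that every entry L i j has a pole of order at most m at z = 0, i.e. (L i j).coeff p = 0 for all integers p < -m. Then for each j with 0 ≤ j ≤ d, the coefficient r_j := (charpoly L).coeff (d - j) of X^{d-j} in the characteristic polynomial of L (a Laurent series in z) has a pole of order at most j·m, i.e. r_j.coeff p = 0 for all integers p < -(j·m). -/
open Matrix Polynomial

/-- A polynomial over `R((z))` has weighted pole order at most `k` (with slope `m`) if its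
coefficient at `X ^ i` has a pole of order at most `(k - i) * m`, for every `i`. -/
def PoleBounded {R : Type*} [CommRing R] (m k : ℤ) (P : (LaurentSeries R)[X]) : Prop :=
  ∀ i : ℕ, ∀ p : ℤ, p < -((k - i) * m) → (P.coeff i).coeff p = 0

namespace PoleBounded

variable {R : Type*} [CommRing R] {m k l : ℤ} {P Q : (LaurentSeries R)[X]}

theorem zero : PoleBounded m k (0 : (LaurentSeries R)[X]) := fun i p _ => by simp

theorem neg (hP : PoleBounded m k P) : PoleBounded m k (-P) := fun i p hp => by
  simp [hP i p hp]

theorem add (hP : PoleBounded m k P) (hQ : PoleBounded m k Q) : PoleBounded m k (P + Q) :=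
  fun i p hp => by simp [hP i p hp, hQ i p hp]

theorem sum {ι : Type*} (s : Finset ι) (f : ι → (LaurentSeries R)[X])
    (hf : ∀ a ∈ s, PoleBounded m k (f a)) : PoleBounded m k (∑ a ∈ s, f a) :=
  Finset.sum_induction f _ (fun _ _ => add) zero hf

theorem units_smul (u : ℤˣ) (hP : PoleBounded m k P) : PoleBounded m k (u • P) := by
  rcases Int.units_eq_one_or u with rfl | rfl
  · simpa using hP
  · simpa using hP.neg

theorem C {f : LaurentSeries R} (hf : ∀ p < -(k * m), f.coeff p = 0) :
    PoleBounded m k (Polynomial.C f) := fun i p hp => by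
  rcases eq_or_ne i 0 with rfl | hi
  · simpa using hf p (by simpa using hp)
  · simp [Polynomial.coeff_C, hi]

theorem one : PoleBounded m 0 (1 : (LaurentSeries R)[X]) :=
  C fun p hp => by
    rw [HahnSeries.coeff_one, if_neg (by lia)]

theorem X : PoleBounded m 1 (Polynomial.X : (LaurentSeries R)[X]) := fun i p hp => by
  rcases eq_or_ne 1 i with rfl | hi
  · rw [Polynomial.coeff_X_one, HahnSeries.coeff_one, if_neg]
    rintro rfl
    simp at hp
  · simp [Polynomial.coeff_X, hi]

theorem mul (hP : PoleBounded m k P) (hQ : PoleBounded m l Q) :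
    PoleBounded m (k + l) (P * Q) := fun i p hp => by
  rw [Polynomial.coeff_mul, HahnSeries.coeff_sum]
  refine Finset.sum_eq_zero fun a ha => ?_
  rw [HahnSeries.coeff_mul]
  refine Finset.sum_eq_zero fun b hb => ?_
  have hi : ((a.1 : ℤ) + a.2) = i := mod_cast Finset.HasAntidiagonal.mem_antidiagonal.mp ha
  have hb' : b.1 + b.2 = p := (Finset.mem_antidiagonal.mp hb).2.2
  by_cases h : b.1 < -((k - a.1) * m)
  · rw [hP a.1 b.1 h, zero_mul]
  · rw [hQ a.2 b.2, mul_zero]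
    rw [← hi] at hp
    linarith

theorem prod {ι : Type*} (s : Finset ι) (f : ι → (LaurentSeries R)[X])
    (hf : ∀ a ∈ s, PoleBounded m 1 (f a)) : PoleBounded m s.card (∏ a ∈ s, f a) := by
  classical
  induction s using Finset.induction_on with
  | empty => simpa using one
  | insert a s ha ih =>
    rw [Finset.prod_insert ha, Finset.card_insert_of_notMem ha, Nat.cast_succ, add_comm]
    exact (hf a (Finset.mem_insert_self a s)).mul
      (ih fun b hb => hf b (Finset.mem_insert_of_mem hb))

theorem charpoly {n : Type*} [Fintype n] [DecidableEq n] {L : Matrix n n (LaurentSeries R)}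
    (hL : ∀ i j, ∀ p < -m, (L i j).coeff p = 0) :
    PoleBounded m (Fintype.card n) L.charpoly := by
  rw [Matrix.charpoly, Matrix.det_apply]
  refine sum _ _ fun σ _ => units_smul _ (prod _ _ fun i _ => ?_)
  have hC : PoleBounded m 1 (Polynomial.C (L (σ i) i)) := C (by simpa using hL (σ i) i)
  rw [Matrix.charmatrix_apply, Matrix.diagonal_apply, sub_eq_add_neg]
  split_ifs
  · exact X.add hC.neg
  · exact zero.add hC.neg

end PoleBounded

/-- If every entry of a matrix `L` over the field `ℂ((z))` of formal Laurent series has a pole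
of order at most `m` at `z = 0`, then the coefficient `r_j` of `X^{d-j}` in the characteristic
polynomial of `L` has a pole of order at most `j·m`.  This is the local form of the statement
`r_j ∈ O(Σ, -jD)` for the coefficients of the spectral curve equation. -/
theorem charpoly_coeff_pole_order {d m : ℕ} (hd : 1 ≤ d)
    (L : Matrix (Fin d) (Fin d) (LaurentSeries ℂ))
    (hL : ∀ i j : Fin d, ∀ p : ℤ, p < -(m : ℤ) → (L i j).coeff p = 0) :
    ∀ j : ℕ, j ≤ d → ∀ p : ℤ, p < -((j : ℤ) * (m : ℤ)) →
      ((Matrix.charpoly L).coeff (d - j)).coeff p = 0 := by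
  intro j hj p hp
  refine PoleBounded.charpoly hL (d - j) p ?_
  rw [Fintype.card_fin, Nat.cast_sub hj, sub_sub_cancel]
  exact hp
end

section
/- Let d ≥ 1, let L ∈ M_d(ℂ) be invertible, and for 0 ≤ j ≤ d define r_j(X) = (charpoly X).coeff (d - j), so that det(λ·1 - X) = Σ_{j=0}^{d} r_j(X)·λ^{d-j} with r_0(X) = 1. Then for each i with 1 ≤ i ≤ d, the map X ↦ r_i(X) is differentiable at L and its gradient with respect to the trace pairing is ∇r_i(L) = Σ_{j=i}^{d} r_j(L)·(L⁻¹)^{j-i+1}; that is, for every H ∈ M_d(ℂ), the derivative of X ↦ (charpoly X).coeff (d - i) at L in the direction H equals trace( (Σ_{j=i}^{d} ((charpoly L).coeff (d-j))·(L⁻¹)^{j-i+1}) · H ). -/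
open Matrix Polynomial

attribute [local instance] Matrix.normedAddCommGroup Matrix.normedSpace

section JacobiFormula

variable {n R : Type*} [Fintype n] [DecidableEq n] [CommRing R]

theorem Matrix.sum_det_updateRow_eq_trace_adjugate_mul (A H : Matrix n n R) :
    ∑ i, (A.updateRow i (H i)).det = (A.adjugate * H).trace := by
  rw [trace_mul_comm]
  refine Finset.sum_congr rfl fun i _ => ?_
  rw [← cramer_transpose_apply, cramer_eq_adjugate_mulVec, ← adjugate_transpose, mulVec_transpose]
  rfl

end JacobiFormula

/-- Jacobi formula for the derivative of the determinant. -/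
theorem Matrix.fderiv_det {n : Type*} [Fintype n] [DecidableEq n] (A H : Matrix n n ℂ) :
    DifferentiableAt ℂ (det : Matrix n n ℂ → ℂ) A ∧
      fderiv ℂ (det : Matrix n n ℂ → ℂ) A H = (A.adjugate * H).trace := by
  let f : ContinuousMultilinearMap ℂ (fun _ : n => n → ℂ) ℂ :=
    { (detRowAlternating (R := ℂ) (n := n)).toMultilinearMap with
      cont := Continuous.matrix_det (A := fun X : Matrix n n ℂ => X) continuous_id }
  have h := f.hasFDerivAt A
  refine ⟨h.differentiableAt, (congrArg (fun g => g H) h.fderiv).trans ?_⟩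
  rw [← sum_det_updateRow_eq_trace_adjugate_mul]
  exact f.linearDeriv_apply A H

section CharpolyCoeff

variable {n : Type*} [Fintype n] [DecidableEq n]

theorem Matrix.differentiable_charpoly_coeff (k : ℕ) :
    Differentiable ℂ fun X : Matrix n n ℂ => X.charpoly.coeff k := by
  by_cases hk : k ≤ Fintype.card n
  · obtain ⟨m, hm⟩ := Nat.exists_eq_add_of_le hk
    obtain rfl : k = Fintype.card n - m := by omega
    have hm' : m ≤ Fintype.card n := by omega
    simp_rw [fun X : Matrix n n ℂ => charpoly_coeff_eq_sum_minors X m hm', det_apply,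
      submatrix_apply]
    fun_prop
  · have : (fun X : Matrix n n ℂ => X.charpoly.coeff k) = fun _ => 0 := by
      funext X
      exact coeff_eq_zero_of_natDegree_lt (by simpa using hk)
    rw [this]
    exact differentiable_const 0

/-- The adjugate of the characteristic matrix generates the gradients of the coefficients of the
characteristic polynomial. -/
theorem Matrix.fderiv_charpoly_coeff (L H : Matrix n n ℂ) (k : ℕ) :
    fderiv ℂ (fun X : Matrix n n ℂ => X.charpoly.coeff k) L H =
      -((matPolyEquiv (adjugate (charmatrix L))).coeff k * H).trace := by
  let N := Fintype.card n + k + 1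
  let D : ℂ[X] := ∑ m ∈ Finset.range N,
    monomial m (fderiv ℂ (fun X : Matrix n n ℂ => X.charpoly.coeff m) L H)
  have hD : D = -(adjugate (charmatrix L) * H.map C).trace := by
    refine Polynomial.funext fun t => ?_
    have hsum : (fun X : Matrix n n ℂ => (scalar n t - X).det) =
        fun X => ∑ m ∈ Finset.range N, X.charpoly.coeff m * t ^ m := by
      funext X
      rw [← eval_charpoly, eval_eq_sum_range' (n := N) (by rw [charpoly_natDegree_eq_dim]; omega)]
    have hl : fderiv ℂ (fun X : Matrix n n ℂ => (scalar n t - X).det) L H = D.eval t := by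
      have h := HasFDerivAt.fun_sum fun m (_ : m ∈ Finset.range N) =>
        (differentiable_charpoly_coeff m L).hasFDerivAt.mul_const (t ^ m)
      rw [hsum]
      refine (congrArg (fun g => g H) h.fderiv).trans ?_
      simp only [D, eval_finsetSum, eval_monomial]
      refine (_root_.sum_apply _ _ _).trans (Finset.sum_congr rfl fun m _ => ?_)
      exact mul_comm _ _
    have hr : fderiv ℂ (fun X : Matrix n n ℂ => (scalar n t - X).det) L H =
        -(adjugate (scalar n t - L) * H).trace := by
      obtain ⟨hd, hd'⟩ := fderiv_det (scalar n t - L) H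
      have h := hd.hasFDerivAt.comp L ((hasFDerivAt_id L).const_sub (scalar n t))
      refine (congrArg (fun g => g H) h.fderiv).trans ?_
      rw [← hd']
      exact map_neg (fderiv ℂ det (scalar n t - L)) H
    have hadj : (adjugate (charmatrix L)).map (eval t) = adjugate (scalar n t - L) := by
      have h := (evalRingHom t).map_adjugate (charmatrix L)
      simp only [RingHom.mapMatrix_apply, coe_evalRingHom] at h
      rw [h, ← matPolyEquiv_eval_eq_map, matPolyEquiv_charmatrix, eval_sub, eval_X, eval_C]
    rw [← hl, hr, ← hadj]
    simp [trace, mul_apply, eval_finsetSum]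
  have hcoeff : D.coeff k = fderiv ℂ (fun X : Matrix n n ℂ => X.charpoly.coeff k) L H := by
    simp [D, coeff_monomial, N]
  rw [← hcoeff, hD]
  simp [trace, mul_apply, matPolyEquiv_coeff_apply]

theorem Matrix.coeff_adjugate_charmatrix (L : Matrix n n ℂ) (hL : IsUnit L) (k : ℕ) :
    (matPolyEquiv (adjugate (charmatrix L))).coeff k =
      -∑ m ∈ Finset.range (k + 1), L.charpoly.coeff m • L⁻¹ ^ (k - m + 1) := by
  have hLL : L * L⁻¹ = 1 := mul_nonsing_inv L ((isUnit_iff_isUnit_det L).1 hL)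
  set B := matPolyEquiv (adjugate (charmatrix L)) with hB
  have key : B * (X - C L) = L.charpoly.map (algebraMap ℂ (Matrix n n ℂ)) := by
    rw [← matPolyEquiv_charmatrix, hB, ← map_mul, adjugate_mul, matPolyEquiv_smul_one]
    rfl
  induction k with
  | zero =>
    have h := congrArg (fun p => p.coeff 0 * L⁻¹) key
    simp only [mul_sub, coeff_sub, coeff_mul_X_zero, coeff_mul_C, coeff_map, sub_mul,
      mul_assoc, hLL] at h
    simpa [Algebra.algebraMap_eq_smul_one, neg_eq_iff_eq_neg] using h
  | succ k ih =>
    have h := congrArg (fun p => p.coeff (k + 1) * L⁻¹) key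
    simp only [mul_sub, coeff_sub, coeff_mul_X, coeff_mul_C, coeff_map, sub_mul, mul_assoc, hLL,
      mul_one, Algebra.algebraMap_eq_smul_one, smul_mul_assoc, one_mul] at h
    rw [sub_eq_iff_eq_add, ← sub_eq_iff_eq_add'] at h
    rw [← h, ih, Finset.sum_range_succ _ (k + 1), neg_add, neg_mul, Finset.sum_mul]
    simp only [Nat.sub_self, zero_add, pow_one, sub_eq_add_neg]
    congr 2
    refine Finset.sum_congr rfl fun m hm => ?_
    rw [smul_mul_assoc, ← pow_succ, Nat.succ_sub (by simpa [Nat.lt_succ_iff] using hm)]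

end CharpolyCoeff

/-- Gradients of the coefficients of the characteristic polynomial: with
`r_j(X) = (charpoly X).coeff (d - j)`, so that `det(λ·1 - X) = Σ_{j=0}^d r_j(X)·λ^{d-j}`,
for invertible `L` the map `X ↦ r_i(X)` is differentiable at `L` and
`∇r_i(L) = Σ_{j=i}^{d} r_j(L)·(L⁻¹)^{j-i+1}` with respect to the trace pairing. -/
theorem grad_charpoly_coeff {d : ℕ} (hd : 1 ≤ d)
    (L : Matrix (Fin d) (Fin d) ℂ) (hL : IsUnit L) :
    ∀ i : ℕ, 1 ≤ i → i ≤ d →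
      DifferentiableAt ℂ
        (fun X : Matrix (Fin d) (Fin d) ℂ => (Matrix.charpoly X).coeff (d - i)) L ∧
      ∀ H : Matrix (Fin d) (Fin d) ℂ,
        fderiv ℂ (fun X : Matrix (Fin d) (Fin d) ℂ => (Matrix.charpoly X).coeff (d - i)) L H
          = Matrix.trace
              ((∑ j ∈ Finset.Icc i d,
                ((Matrix.charpoly L).coeff (d - j)) • (L⁻¹) ^ (j - i + 1)) * H) := by
  intro i hi hid
  refine ⟨(differentiable_charpoly_coeff (d - i)).differentiableAt, fun H => ?_⟩
  rw [fderiv_charpoly_coeff, coeff_adjugate_charmatrix L hL, neg_mul, trace_neg, neg_neg]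
  congr 2
  refine Finset.sum_bij' (fun m _ => d - m) (fun j _ => d - j) ?_ ?_ ?_ ?_ ?_ <;>
    simp only [Finset.mem_range, Finset.mem_Icc]
  iterate 4 intros; omega
  intro m hm
  rw [show d - (d - m) = m by omega, show d - m - i = d - i - m by omega]
end
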